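/- arXiv:2505.14702 — 2 statements merged into one kernel-verified Lean document; each statement's English description precedes it below -/
import Mathlib

section
/- For all real numbers B₁, B₂, B₃, C₁, C₂, C₃, the determinant of the 12×12 real matrix M whose rows are (reading unknowns in the order φ₁₁,φ₁₂,φ₁₃,φ₂₁,φ₂₂,φ₂₃,φ₃₁,φ₃₂,φ₃₃,φ₄₁,φ₄₂,φ₄₃): row 1 = (0,−C₃,C₂,0,0,0,0,0,−B₂,0,B₃,0); row 2 = (C₃,0,−C₁,0,0,B₁,0,0,0,−B₃,0,0); row 3 = (−C₂,C₁,0,0,−B₁,0,B₂,0,0,0,0,0); row 4 = (0,0,0,0,−C₃,C₂,0,B₃,0,0,0,B₂); row 5 = (0,0,−B₁,C₃,0,−C₁,−B₃,0,0,0,0,0); row 6 = (0,B₁,0,−C₂,C₁,0,0,0,0,−B₂,0,0); row 7 = (0,0,B₂,0,−B₃,0,0,−C₃,C₂,0,0,0); row 8 = (0,0,0,B₃,0,0,C₃,0,−C₁,0,0,B₁); row 9 = (−B₂,0,0,0,0,0,−C₂,C₁,0,0,−B₁,0); row 10 = (0,−B₃,0,0,0,−B₂,0,0,0,0,−C₃,C₂);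 row 11 = (B₃,0,0,0,0,0,0,0,−B₁,C₃,0,−C₁); row 12 = (0,0,0,B₂,0,0,0,B₁,0,−C₂,C₁,0), satisfies det M = 16·(B₁²B₂²B₃² + C₁²B₂²B₃² + B₁²C₂²B₃² + B₁²B₂²C₃²)². -/
open Matrix Quaternion

/-- Division-free Schur complement for the cross product block matrix of three square blocks. -/
theorem pow_mul_det_fromBlocks_cross {n R : Type*} [Fintype n] [DecidableEq n] [CommRing R]
    (a b c d : Matrix n n R) (s : R) (h : c * d = s • 1) :
    s ^ Fintype.card n *
      (fromBlocks (fromBlocks 0 (-c) c 0) (fromRows b (-a)) (fromCols (-b) a) 0).det =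
      c.det ^ 2 * (a * d * b - b * d * a).det := by
  have hJ : (fromBlocks 0 (-c) c 0).det = c.det ^ 2 := by
    have h₁ : fromBlocks 0 (-c) c 0 * fromBlocks (1 : Matrix n n R) 1 0 1 =
        fromBlocks c 0 0 c * fromBlocks 0 (-1) 1 1 := by
      simp [fromBlocks_multiply]
    have h₂ := congrArg det h₁
    simpa [det_mul, det_fromBlocks_one₂₂, sq] using h₂
  have hM : fromBlocks (fromBlocks 0 (-c) c 0) (fromRows b (-a)) (fromCols (-b) a) 0 *
      fromBlocks 1 (fromRows (d * a) (d * b)) 0 (s • 1) =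
      fromBlocks (fromBlocks 0 (-c) c 0) 0 (fromCols (-b) a) (a * d * b - b * d * a) := by
    rw [fromBlocks_multiply]
    congr 1
    · simp
    · rw [fromBlocks_mul_fromRows]
      ext (i | i) j <;> simp [← Matrix.mul_assoc, h]
    · simp
    · simp [fromCols_mul_fromRows, ← Matrix.mul_assoc, sub_eq_neg_add]
  have hdet := congrArg det hM
  rw [det_mul, det_fromBlocks_zero₂₁, det_fromBlocks_zero₁₂, hJ] at hdet
  simpa [mul_comm] using hdet

/-- The matrix of left multiplication by a quaternion in the basis `1, i, j, k`. -/
def quaternionLeftMatrix (q : ℍ[ℝ]) : Matrix (Fin 4) (Fin 4) ℝ :=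
  !![q.re, -q.imI, -q.imJ, -q.imK;
     q.imI, q.re, -q.imK, q.imJ;
     q.imJ, q.imK, q.re, -q.imI;
     q.imK, -q.imJ, q.imI, q.re]

theorem quaternionLeftMatrix_mul (p q : ℍ[ℝ]) :
    quaternionLeftMatrix (p * q) = quaternionLeftMatrix p * quaternionLeftMatrix q := by
  ext i j
  fin_cases i <;> fin_cases j <;>
    simp [quaternionLeftMatrix, Matrix.mul_apply, Fin.sum_univ_four] <;> ring

theorem quaternionLeftMatrix_sub (p q : ℍ[ℝ]) :
    quaternionLeftMatrix (p - q) = quaternionLeftMatrix p - quaternionLeftMatrix q := by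
  ext i j
  fin_cases i <;> fin_cases j <;> simp [quaternionLeftMatrix] <;> ring

theorem quaternionLeftMatrix_coe (r : ℝ) :
    quaternionLeftMatrix (r : ℍ[ℝ]) = r • 1 := by
  ext i j
  fin_cases i <;> fin_cases j <;> simp [quaternionLeftMatrix]

theorem det_quaternionLeftMatrix (q : ℍ[ℝ]) :
    (quaternionLeftMatrix q).det = normSq q ^ 2 := by
  simp [quaternionLeftMatrix, det_succ_row_zero, Fin.sum_univ_succ, Fin.succAbove, normSq_def']
  ring

theorem continuous_quaternionLeftMatrix : Continuous quaternionLeftMatrix := by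
  refine continuous_matrix fun i j => ?_
  fin_cases i <;> fin_cases j <;>
    first
    | exact continuous_re
    | exact continuous_imI
    | exact continuous_imJ
    | exact continuous_imK
    | exact continuous_imI.neg
    | exact continuous_imJ.neg
    | exact continuous_imK.neg

/-- The matrix of the cross product with a vector of three quaternions. -/
def quaternionCrossMatrix (p q r : ℍ[ℝ]) :
    Matrix ((Fin 4 ⊕ Fin 4) ⊕ Fin 4) ((Fin 4 ⊕ Fin 4) ⊕ Fin 4) ℝ :=
  let a := quaternionLeftMatrix p
  let b := quaternionLeftMatrix q
  let c := quaternionLeftMatrix r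
  fromBlocks (fromBlocks 0 (-c) c 0) (fromRows b (-a)) (fromCols (-b) a) 0

theorem continuous_det_quaternionCrossMatrix (p q : ℍ[ℝ]) :
    Continuous fun r => (quaternionCrossMatrix p q r).det := by
  have h := continuous_quaternionLeftMatrix
  exact (Continuous.matrix_fromBlocks (Continuous.matrix_fromBlocks continuous_const h.neg h
    continuous_const) continuous_const continuous_const continuous_const).matrix_det

theorem det_quaternionCrossMatrix (p q r : ℍ[ℝ]) :
    (quaternionCrossMatrix p q r).det = normSq (p * star r * q - q * star r * p) ^ 2 := by
  have hcont : Continuous fun r : ℍ[ℝ] => normSq (p * star r * q - q * star r * p) ^ 2 :=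
    (continuous_normSq.comp (((continuous_const.mul continuous_star).mul continuous_const).sub
      ((continuous_const.mul continuous_star).mul continuous_const))).pow 2
  have hne : Set.EqOn (fun r => (quaternionCrossMatrix p q r).det)
      (fun r => normSq (p * star r * q - q * star r * p) ^ 2) {0}ᶜ := by
    intro r hr
    have h := pow_mul_det_fromBlocks_cross (quaternionLeftMatrix p) (quaternionLeftMatrix q)
      (quaternionLeftMatrix r) (quaternionLeftMatrix (star r)) (normSq r)
      (by rw [← quaternionLeftMatrix_mul, self_mul_star, quaternionLeftMatrix_coe])
    simp only [← quaternionLeftMatrix_mul, ← quaternionLeftMatrix_sub,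
      det_quaternionLeftMatrix, Fintype.card_fin] at h
    rw [← pow_mul] at h
    exact mul_left_cancel₀ (pow_ne_zero 4 (normSq_ne_zero.mpr hr)) h
  exact congrFun (Continuous.ext_on (dense_compl_singleton 0)
    (continuous_det_quaternionCrossMatrix p q) hcont hne) r

/-- Splits the indices `0, …, 11` by their residues modulo `3`. -/
noncomputable def residueBlockEquiv : (Fin 4 ⊕ Fin 4) ⊕ Fin 4 ≃ Fin 12 :=
  Equiv.ofBijective
    (Sum.elim (Sum.elim ![0, 3, 6, 9] ![1, 4, 7, 10]) ![2, 5, 8, 11]) (by decide)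

/-- The determinant of the 12×12 coefficient matrix of the linear system
`[B·φ] + [C,φ] = 0` from the proof of Lemma 3 equals
`16 (B₁²B₂²B₃² + C₁²B₂²B₃² + B₁²C₂²B₃² + B₁²B₂²C₃²)²`. -/
theorem perturbed_VW_det_formula (B₁ B₂ B₃ C₁ C₂ C₃ : ℝ) :
    (!![0, -C₃, C₂, 0, 0, 0, 0, 0, -B₂, 0, B₃, 0;
       C₃, 0, -C₁, 0, 0, B₁, 0, 0, 0, -B₃, 0, 0;
       -C₂, C₁, 0, 0, -B₁, 0, B₂, 0, 0, 0, 0, 0;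
       0, 0, 0, 0, -C₃, C₂, 0, B₃, 0, 0, 0, B₂;
       0, 0, -B₁, C₃, 0, -C₁, -B₃, 0, 0, 0, 0, 0;
       0, B₁, 0, -C₂, C₁, 0, 0, 0, 0, -B₂, 0, 0;
       0, 0, B₂, 0, -B₃, 0, 0, -C₃, C₂, 0, 0, 0;
       0, 0, 0, B₃, 0, 0, C₃, 0, -C₁, 0, 0, B₁;
       -B₂, 0, 0, 0, 0, 0, -C₂, C₁, 0, 0, -B₁, 0;
       0, -B₃, 0, 0, 0, -B₂, 0, 0, 0, 0, -C₃, C₂;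
       B₃, 0, 0, 0, 0, 0, 0, 0, -B₁, C₃, 0, -C₁;
       0, 0, 0, B₂, 0, 0, 0, B₁, 0, -C₂, C₁, 0] :
      Matrix (Fin 12) (Fin 12) ℝ).det
      = 16 * (B₁ ^ 2 * B₂ ^ 2 * B₃ ^ 2 + C₁ ^ 2 * B₂ ^ 2 * B₃ ^ 2
          + B₁ ^ 2 * C₂ ^ 2 * B₃ ^ 2 + B₁ ^ 2 * B₂ ^ 2 * C₃ ^ 2) ^ 2 := by
  rw [← det_submatrix_equiv_self residueBlockEquiv]
  have exists_coords (x₀ x₁ x₂ x₃ : ℝ) :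
      ∃ q : ℍ[ℝ], q.re = x₀ ∧ q.imI = x₁ ∧ q.imJ = x₂ ∧ q.imK = x₃ :=
    ⟨⟨x₀, x₁, x₂, x₃⟩, rfl, rfl, rfl, rfl⟩
  obtain ⟨p, hp₀, hp₁, hp₂, hp₃⟩ := exists_coords C₁ B₁ 0 0
  obtain ⟨q, hq₀, hq₁, hq₂, hq₃⟩ := exists_coords C₂ 0 B₂ 0
  obtain ⟨r, hr₀, hr₁, hr₂, hr₃⟩ := exists_coords C₃ 0 0 B₃
  trans (quaternionCrossMatrix p q r).det
  · congr 1
    ext ((i | i) | i) ((j | j) | j) <;> fin_cases i <;> fin_cases j <;>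
      simp [residueBlockEquiv, quaternionCrossMatrix, quaternionLeftMatrix, *]
  · rw [det_quaternionCrossMatrix, normSq_def']
    simp [*]
    ring
end

section
/- For all real numbers B₁, B₂, B₃, C₁, C₂, C₃ with B₁·B₂·B₃ ≠ 0, the determinant of the 12×12 real matrix M described below is strictly positive; in particular M is invertible. The rows of M are (in the variable order φ₁₁,φ₁₂,φ₁₃,φ₂₁,φ₂₂,φ₂₃,φ₃₁,φ₃₂,φ₃₃,φ₄₁,φ₄₂,φ₄₃): row 1 = (0,−C₃,C₂,0,0,0,0,0,−B₂,0,B₃,0); row 2 = (C₃,0,−C₁,0,0,B₁,0,0,0,−B₃,0,0); row 3 = (−C₂,C₁,0,0,−B₁,0,B₂,0,0,0,0,0); row 4 = (0,0,0,0,−C₃,C₂,0,B₃,0,0,0,B₂); row 5 = (0,0,−B₁,C₃,0,−C₁,−B₃,0,0,0,0,0); row 6 = (0,B₁,0,−C₂,C₁,0,0,0,0,−B₂,0,0); row 7 = (0,0,B₂,0,−B₃,0,0,−C₃,C₂,0,0,0); row 8 = (0,0,0,B₃,0,0,C₃,0,−C₁,0,0,B₁); row 9 = (−B₂,0,0,0,0,0,−C₂,C₁,0,0,−B₁,0);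 row 10 = (0,−B₃,0,0,0,−B₂,0,0,0,0,−C₃,C₂); row 11 = (B₃,0,0,0,0,0,0,0,−B₁,C₃,0,−C₁); row 12 = (0,0,0,B₂,0,0,0,B₁,0,−C₂,C₁,0). -/
open Matrix

/-- The determinant of the block matrix with rows `(0, -Z)` and `(Z, 0)`. -/
theorem det_fromBlocks_zero_neg_zero {n R : Type*} [Fintype n] [DecidableEq n] [CommRing R]
    (Z : Matrix n n R) : (fromBlocks 0 (-Z) Z 0).det = Z.det ^ 2 := by
  have h : fromBlocks 0 (-Z) Z 0 =
      fromBlocks 1 (-1) 0 1 * fromBlocks 1 0 1 1 * fromBlocks 1 (-1) 0 1 * fromBlocks Z 0 0 Z := by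
    simp [fromBlocks_multiply]
  rw [h]
  simp [det_mul, sq]

/-- The determinant of the cross-product matrix of three square blocks, where `Z` is invertible
with inverse `W`. -/
theorem det_cross_fromBlocks {n R : Type*} [Fintype n] [DecidableEq n] [CommRing R]
    (X Y Z W : Matrix n n R) (h : Z * W = 1) :
    (fromBlocks (fromBlocks 0 (-Z) Z 0) (fromRows Y (-X)) (fromCols (-Y) X) 0).det =
      Z.det ^ 2 * (X * W * Y - Y * W * X).det := by
  have h' : W * Z = 1 := mul_eq_one_comm.mp h
  let _ : Invertible (fromBlocks 0 (-Z) Z 0) :=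
    ⟨fromBlocks 0 W (-W) 0, by simp [fromBlocks_multiply, h'], by simp [fromBlocks_multiply, h]⟩
  have hinv : ⅟(fromBlocks 0 (-Z) Z 0) = fromBlocks 0 W (-W) 0 := rfl
  rw [det_fromBlocks₁₁, det_fromBlocks_zero_neg_zero, hinv, Matrix.mul_assoc,
    fromBlocks_mul_fromRows, fromCols_mul_fromRows]
  congr 2
  simp [Matrix.mul_assoc, sub_eq_add_neg, add_comm]

/-- The matrix of left multiplication by the quaternion `a + b i + c j + d k`. -/
def quaternionLeftMul {R : Type*} [CommRing R] (a b c d : R) : Matrix (Fin 4) (Fin 4) R :=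
  !![a, -b, -c, -d; b, a, -d, c; c, d, a, -b; d, -c, b, a]

theorem quaternionLeftMul_mul {R : Type*} [CommRing R] (a b c d a' b' c' d' : R) :
    quaternionLeftMul a b c d * quaternionLeftMul a' b' c' d' =
      quaternionLeftMul (a * a' - b * b' - c * c' - d * d') (a * b' + b * a' + c * d' - d * c')
        (a * c' - b * d' + c * a' + d * b') (a * d' + b * c' - c * b' + d * a') := by
  ext i j
  fin_cases i <;> fin_cases j <;>
    simp [quaternionLeftMul, Matrix.mul_apply, Fin.sum_univ_four] <;> ring

theorem quaternionLeftMul_sub {R : Type*} [CommRing R] (a b c d a' b' c' d' : R) :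
    quaternionLeftMul a b c d - quaternionLeftMul a' b' c' d' =
      quaternionLeftMul (a - a') (b - b') (c - c') (d - d') := by
  ext i j
  fin_cases i <;> fin_cases j <;> simp [quaternionLeftMul] <;> ring

theorem quaternionLeftMul_one {R : Type*} [CommRing R] :
    quaternionLeftMul (1 : R) 0 0 0 = 1 := by
  ext i j
  fin_cases i <;> fin_cases j <;> simp [quaternionLeftMul]

theorem det_quaternionLeftMul {R : Type*} [CommRing R] (a b c d : R) :
    (quaternionLeftMul a b c d).det = (a ^ 2 + b ^ 2 + c ^ 2 + d ^ 2) ^ 2 := by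
  simp [quaternionLeftMul, det_succ_row_zero, Fin.sum_univ_succ, Fin.succAbove]
  ring

/-- The bijection sending the `i`-th index of the `j`-th block to `3 * i + j`. -/
noncomputable def interleaveEquiv : (Fin 4 ⊕ Fin 4) ⊕ Fin 4 ≃ Fin 12 :=
  Equiv.ofBijective
    (Sum.elim (Sum.elim ![0, 3, 6, 9] ![1, 4, 7, 10]) ![2, 5, 8, 11]) (by decide)

theorem det_cross_quaternionLeftMul {K : Type*} [Field K] (B₁ B₂ B₃ C₁ C₂ C₃ : K)
    (h : C₃ ^ 2 + B₃ ^ 2 ≠ 0) :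
    (fromBlocks (fromBlocks 0 (-quaternionLeftMul C₃ 0 0 B₃) (quaternionLeftMul C₃ 0 0 B₃) 0)
      (fromRows (quaternionLeftMul C₂ 0 B₂ 0) (-quaternionLeftMul C₁ B₁ 0 0))
      (fromCols (-quaternionLeftMul C₂ 0 B₂ 0) (quaternionLeftMul C₁ B₁ 0 0)) 0).det =
    16 * ((B₁ * B₂ * B₃) ^ 2 + (C₁ * B₂ * B₃) ^ 2 + (B₁ * C₂ * B₃) ^ 2
      + (B₁ * B₂ * C₃) ^ 2) ^ 2 := by
  rw [det_cross_fromBlocks _ _ _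
    (quaternionLeftMul (C₃ / (C₃ ^ 2 + B₃ ^ 2)) 0 0 (-B₃ / (C₃ ^ 2 + B₃ ^ 2)))]
  · simp only [quaternionLeftMul_mul, quaternionLeftMul_sub, det_quaternionLeftMul]
    field_simp
    ring
  · rw [quaternionLeftMul_mul, ← quaternionLeftMul_one]
    congr 1 <;> field_simp <;> ring

/-- The closed form of the determinant of the perturbed coefficient matrix. -/
theorem perturbed_VW_det_eq (B₁ B₂ B₃ C₁ C₂ C₃ : ℝ) (h : C₃ ^ 2 + B₃ ^ 2 ≠ 0) :
    (!![0, -C₃, C₂, 0, 0, 0, 0, 0, -B₂, 0, B₃, 0;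
       C₃, 0, -C₁, 0, 0, B₁, 0, 0, 0, -B₃, 0, 0;
       -C₂, C₁, 0, 0, -B₁, 0, B₂, 0, 0, 0, 0, 0;
       0, 0, 0, 0, -C₃, C₂, 0, B₃, 0, 0, 0, B₂;
       0, 0, -B₁, C₃, 0, -C₁, -B₃, 0, 0, 0, 0, 0;
       0, B₁, 0, -C₂, C₁, 0, 0, 0, 0, -B₂, 0, 0;
       0, 0, B₂, 0, -B₃, 0, 0, -C₃, C₂, 0, 0, 0;
       0, 0, 0, B₃, 0, 0, C₃, 0, -C₁, 0, 0, B₁;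
       -B₂, 0, 0, 0, 0, 0, -C₂, C₁, 0, 0, -B₁, 0;
       0, -B₃, 0, 0, 0, -B₂, 0, 0, 0, 0, -C₃, C₂;
       B₃, 0, 0, 0, 0, 0, 0, 0, -B₁, C₃, 0, -C₁;
       0, 0, 0, B₂, 0, 0, 0, B₁, 0, -C₂, C₁, 0] :
      Matrix (Fin 12) (Fin 12) ℝ).det =
    16 * ((B₁ * B₂ * B₃) ^ 2 + (C₁ * B₂ * B₃) ^ 2 + (B₁ * C₂ * B₃) ^ 2
      + (B₁ * B₂ * C₃) ^ 2) ^ 2 := by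
  rw [← det_cross_quaternionLeftMul _ _ _ _ _ _ h, ← det_submatrix_equiv_self interleaveEquiv]
  congr 1
  ext i j
  rcases i with (i | i) | i <;> rcases j with (j | j) | j <;> fin_cases i <;> fin_cases j <;>
    simp [interleaveEquiv, quaternionLeftMul]


/-- If `B₁ * B₂ * B₃ ≠ 0`, the determinant of the 12×12 coefficient matrix of the
linear system `[B·φ] + [C,φ] = 0` from the proof of Lemma 3 is strictly positive;
in particular the matrix is invertible. -/
theorem perturbed_VW_det_pos (B₁ B₂ B₃ C₁ C₂ C₃ : ℝ) (hB : B₁ * B₂ * B₃ ≠ 0) :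
    0 < (!![0, -C₃, C₂, 0, 0, 0, 0, 0, -B₂, 0, B₃, 0;
       C₃, 0, -C₁, 0, 0, B₁, 0, 0, 0, -B₃, 0, 0;
       -C₂, C₁, 0, 0, -B₁, 0, B₂, 0, 0, 0, 0, 0;
       0, 0, 0, 0, -C₃, C₂, 0, B₃, 0, 0, 0, B₂;
       0, 0, -B₁, C₃, 0, -C₁, -B₃, 0, 0, 0, 0, 0;
       0, B₁, 0, -C₂, C₁, 0, 0, 0, 0, -B₂, 0, 0;
       0, 0, B₂, 0, -B₃, 0, 0, -C₃, C₂, 0, 0, 0;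
       0, 0, 0, B₃, 0, 0, C₃, 0, -C₁, 0, 0, B₁;
       -B₂, 0, 0, 0, 0, 0, -C₂, C₁, 0, 0, -B₁, 0;
       0, -B₃, 0, 0, 0, -B₂, 0, 0, 0, 0, -C₃, C₂;
       B₃, 0, 0, 0, 0, 0, 0, 0, -B₁, C₃, 0, -C₁;
       0, 0, 0, B₂, 0, 0, 0, B₁, 0, -C₂, C₁, 0] :
      Matrix (Fin 12) (Fin 12) ℝ).det
    ∧ IsUnit (!![0, -C₃, C₂, 0, 0, 0, 0, 0, -B₂, 0, B₃, 0;
       C₃, 0, -C₁, 0, 0, B₁, 0, 0, 0, -B₃, 0, 0;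
       -C₂, C₁, 0, 0, -B₁, 0, B₂, 0, 0, 0, 0, 0;
       0, 0, 0, 0, -C₃, C₂, 0, B₃, 0, 0, 0, B₂;
       0, 0, -B₁, C₃, 0, -C₁, -B₃, 0, 0, 0, 0, 0;
       0, B₁, 0, -C₂, C₁, 0, 0, 0, 0, -B₂, 0, 0;
       0, 0, B₂, 0, -B₃, 0, 0, -C₃, C₂, 0, 0, 0;
       0, 0, 0, B₃, 0, 0, C₃, 0, -C₁, 0, 0, B₁;
       -B₂, 0, 0, 0, 0, 0, -C₂, C₁, 0, 0, -B₁, 0;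
       0, -B₃, 0, 0, 0, -B₂, 0, 0, 0, 0, -C₃, C₂;
       B₃, 0, 0, 0, 0, 0, 0, 0, -B₁, C₃, 0, -C₁;
       0, 0, 0, B₂, 0, 0, 0, B₁, 0, -C₂, C₁, 0] :
      Matrix (Fin 12) (Fin 12) ℝ) := by
  have hB₃ : B₃ ≠ 0 := right_ne_zero_of_mul hB
  have hdet := perturbed_VW_det_eq B₁ B₂ B₃ C₁ C₂ C₃ (by positivity)
  rw [isUnit_iff_isUnit_det, hdet]
  have hpos : 0 < 16 * ((B₁ * B₂ * B₃) ^ 2 + (C₁ * B₂ * B₃) ^ 2 + (B₁ * C₂ * B₃) ^ 2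
      + (B₁ * B₂ * C₃) ^ 2) ^ 2 := by
    have := sq_pos_of_ne_zero hB
    positivity
  exact ⟨hpos, hpos.ne'.isUnit⟩
end
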